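/- arXiv:1605.06901 — 2 statements merged into one kernel-verified Lean document; each statement's English description precedes it below -/
import Mathlib

section
/- In 𝓕 the following relations hold: ⁅E₁, F₂⁆ = 0, ⁅E₂, F₁⁆ = 0, ⁅H₁, E₁⁆ = 2•E₁, ⁅H₂, E₂⁆ = 2•E₂, ⁅H₁, E₂⁆ = -3•E₂, ⁅H₂, E₁⁆ = -3•E₁, and the Serre-type vanishings (ad E₂)⁴(E₁) = 0, (ad E₁)⁴(E₂) = 0, (ad F₂)⁴(F₁) = 0, (ad F₁)⁴(F₂) = 0. -/
/-! Statement 2: Serre relations of the rank 2 hyperbolic Cartan matrix B = !![2,-3;-3,2]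
satisfied by E₁, E₂, F₁, F₂, H₁, H₂ inside 𝓕. -/

noncomputable section

open CartanMatrix

/-- The generalized Cartan matrix of the rank 3 hyperbolic Kac-Moody algebra 𝓕. -/
def Amat : Matrix (Fin 3) (Fin 3) ℤ := !![2, -2, 0; -2, 2, -1; 0, -1, 2]

/-- The rank 3 hyperbolic Kac-Moody algebra 𝓕 over ℚ. -/
abbrev 𝓕 : Type := Matrix.ToLieAlgebra ℚ Amat

/-- The Chevalley generator eᵢ of 𝓕 (index `i : Fin 3`, with `e 0 = e₁`, etc.). -/
def e (i : Fin 3) : 𝓕 :=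
  LieSubmodule.Quotient.mk (N := Relations.toIdeal ℚ Amat)
    (FreeLieAlgebra.of ℚ (Generators.E i))

/-- The Chevalley generator fᵢ of 𝓕. -/
def f (i : Fin 3) : 𝓕 :=
  LieSubmodule.Quotient.mk (N := Relations.toIdeal ℚ Amat)
    (FreeLieAlgebra.of ℚ (Generators.F i))

/-- The Chevalley generator hᵢ of 𝓕. -/
def h (i : Fin 3) : 𝓕 :=
  LieSubmodule.Quotient.mk (N := Relations.toIdeal ℚ Amat)
    (FreeLieAlgebra.of ℚ (Generators.H i))

/-- E₁ := (1/2)•⁅e₁,⁅e₁,⁅e₂,e₃⁆⁆⁆. -/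
def E₁ : 𝓕 := (1/2 : ℚ) • ⁅e 0, ⁅e 0, ⁅e 1, e 2⁆⁆⁆

/-- E₂ := e₂. -/
def E₂ : 𝓕 := e 1

/-- F₁ := -(1/2)•⁅f₁,⁅f₁,⁅f₂,f₃⁆⁆⁆. -/
def F₁ : 𝓕 := -((1/2 : ℚ) • ⁅f 0, ⁅f 0, ⁅f 1, f 2⁆⁆⁆)

/-- F₂ := f₂. -/
def F₂ : 𝓕 := f 1

/-- H₁ := 2h₁ + h₂ + h₃. -/
def H₁ : 𝓕 := (2 : ℚ) • h 0 + h 1 + h 2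

/-- H₂ := h₂. -/
def H₂ : 𝓕 := h 1

theorem iterate_derivation_mul {A : Type*} [Ring A] (δ : A →+ A)
    (hδ : ∀ u v, δ (u * v) = δ u * v + u * δ v) (n : ℕ) (u v : A) :
    δ^[n] (u * v) =
      ∑ ij ∈ Finset.HasAntidiagonal.antidiagonal n, n.choose ij.1 • (δ^[ij.1] u * δ^[ij.2] v) := by
  induction n with
  | zero => simp
  | succ n ih =>
    rw [Finset.sum_antidiagonal_choose_succ_nsmul (fun i j => δ^[i] u * δ^[j] v) n]
    simp only [Function.iterate_succ_apply', ih, map_sum, map_nsmul, hδ, nsmul_add,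
      Finset.sum_add_distrib]
    rw [add_comm]
    congr 1
    refine Finset.sum_congr rfl fun ij hij => ?_
    rw [Finset.HasAntidiagonal.mem_antidiagonal] at hij
    rw [Nat.choose_symm_of_eq_add hij.symm]

theorem iterate_derivation_eq_zero_of_le {A : Type*} [Ring A] (δ : A →+ A) {m n : ℕ} (hmn : m ≤ n)
    {u : A} (hu : δ^[m] u = 0) : δ^[n] u = 0 := by
  obtain ⟨k, rfl⟩ := Nat.exists_eq_add_of_le hmn
  rw [add_comm, Function.iterate_add_apply, hu, iterate_map_zero]

/-- If a derivation `δ` satisfies `δᵏ⁺¹ x = 0`, then `δᵏⁿ (xⁿ)` is a nonzero multiple of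
`(δᵏ x)ⁿ`, and `δᵏⁿ⁺¹ (xⁿ) = 0`. -/
theorem iterate_derivation_pow {A : Type*} [Ring A] (δ : A →+ A)
    (hδ : ∀ u v, δ (u * v) = δ u * v + u * δ v) {k : ℕ} {x : A} (hx : δ^[k + 1] x = 0) (n : ℕ) :
    (∃ c : ℕ, c ≠ 0 ∧ δ^[k * n] (x ^ n) = c • (δ^[k] x) ^ n) ∧ δ^[k * n + 1] (x ^ n) = 0 := by
  induction n with
  | zero =>
    have h1 : δ 1 = 0 := by simpa using hδ 1 1
    exact ⟨⟨1, one_ne_zero, by simp⟩, by simpa using h1⟩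
  | succ n ih =>
    obtain ⟨⟨c, hc, ih⟩, ih'⟩ := ih
    have key : ∀ i j, k * n < i ∨ k < j → δ^[i] (x ^ n) * δ^[j] x = 0 := by
      rintro i j (hi | hj)
      · rw [iterate_derivation_eq_zero_of_le δ hi ih', zero_mul]
      · rw [iterate_derivation_eq_zero_of_le δ hj hx, mul_zero]
    refine ⟨⟨(k * (n + 1)).choose (k * n) * c,
      mul_ne_zero (Nat.choose_pos (by gcongr; omega)).ne' hc, ?_⟩, ?_⟩
    · rw [pow_succ, iterate_derivation_mul δ hδ, Finset.sum_eq_single (k * n, k)]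
      · rw [ih, mul_smul, smul_mul_assoc, ← pow_succ]
      · rintro ⟨i, j⟩ hij hne
        rw [Finset.HasAntidiagonal.mem_antidiagonal, mul_add, mul_one] at hij
        rw [key i j, smul_zero]
        by_contra! hcon
        exact hne (Prod.ext (by simp only at hij ⊢; omega) (by simp only at hij ⊢; omega))
      · intro hmem
        exact absurd (Finset.HasAntidiagonal.mem_antidiagonal.2 (by ring)) hmem
    · rw [pow_succ, iterate_derivation_mul δ hδ]
      refine Finset.sum_eq_zero fun ij hij => ?_
      rw [Finset.HasAntidiagonal.mem_antidiagonal, mul_add, mul_one] at hij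
      rw [key, smul_zero]
      omega

section LieAlgebra

variable {L : Type*} [LieRing L] [LieAlgebra ℚ L]

open LieAlgebra

theorem ad_pow_lie_eq_zero {x u v : L} {m n : ℕ} (hu : (ad ℚ L x ^ (m + 1)) u = 0)
    (hv : (ad ℚ L x ^ (n + 1)) v = 0) : (ad ℚ L x ^ (m + n + 1)) ⁅u, v⁆ = 0 := by
  rw [ad_pow_lie]
  refine Finset.sum_eq_zero fun ij hij => ?_
  rw [Finset.HasAntidiagonal.mem_antidiagonal] at hij
  obtain hi | hj : m + 1 ≤ ij.1 ∨ n + 1 ≤ ij.2 := by omega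
  · rw [Module.End.pow_map_zero_of_le hi hu, zero_lie, smul_zero]
  · rw [Module.End.pow_map_zero_of_le hj hv, lie_zero, smul_zero]

/-- If `(ad d)ᵏ⁺¹ x = 0` and `(ad x)ⁿ` kills every `(ad d)ʲ y`, then `(ad ((ad d)ᵏ x))ⁿ` kills
`y`. -/
theorem ad_ad_pow_pow_eq_zero {d x y : L} {k n : ℕ} (hx : (ad ℚ L d ^ (k + 1)) x = 0)
    (hy : ∀ j, (ad ℚ L x ^ n) ((ad ℚ L d ^ j) y) = 0) :
    (ad ℚ L ((ad ℚ L d ^ k) x) ^ n) y = 0 := by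
  let D : Module.End ℚ L := ad ℚ L d
  let δ : Module.End ℚ L →+ Module.End ℚ L := AddMonoidHom.mulLeft D - AddMonoidHom.mulRight D
  have δ_apply (u) : δ u = D * u - u * D := rfl
  have hδ (u v) : δ (u * v) = δ u * v + u * δ v := by
    simp only [δ_apply]
    noncomm_ring
  have δ_ad (m : ℕ) : δ^[m] (ad ℚ L x) = ad ℚ L ((ad ℚ L d ^ m) x) := by
    induction m with
    | zero => simp
    | succ m ih =>
      ext z
      simp [Function.iterate_succ_apply', ih, δ_apply, D, pow_succ']
  have kills (m : ℕ) : ∀ j, δ^[m] (ad ℚ L x ^ n) ((D ^ j) y) = 0 := by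
    induction m with
    | zero => exact hy
    | succ m ih =>
      intro j
      rw [Function.iterate_succ_apply', δ_apply, LinearMap.sub_apply, Module.End.mul_apply,
        Module.End.mul_apply, ih, map_zero, ← Module.End.mul_apply D, ← pow_succ', ih, sub_zero]
  obtain ⟨⟨c, hc, hpow⟩, -⟩ :=
    iterate_derivation_pow δ hδ (x := ad ℚ L x) (k := k) (by rw [δ_ad, hx, map_zero]) n
  have hzero := kills (k * n) 0
  rw [hpow, δ_ad, pow_zero, Module.End.one_apply, LinearMap.smul_apply] at hzero
  rw [← Nat.cast_smul_eq_nsmul ℚ] at hzero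
  exact (smul_eq_zero.1 hzero).resolve_left (Nat.cast_ne_zero.2 hc)

/-- A lowest weight vector of weight `-n` for an `sl₂`-triple `(h, e, f)` which is killed by
`(ad e)ⁿ⁺²` is already killed by `(ad e)ⁿ⁺¹`. -/
theorem ad_pow_succ_eq_zero_of_lowest_weight {h e f v : L} {n : ℕ} (hef : ⁅e, f⁆ = h)
    (he : ⁅h, e⁆ = (2 : ℚ) • e) (hv : ⁅h, v⁆ = (-n : ℚ) • v) (fv : ⁅f, v⁆ = 0)
    (hnil : (ad ℚ L e ^ (n + 2)) v = 0) : (ad ℚ L e ^ (n + 1)) v = 0 := by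
  have weight (k : ℕ) : ⁅h, (ad ℚ L e ^ k) v⁆ = (2 * k - n : ℚ) • (ad ℚ L e ^ k) v := by
    induction k with
    | zero => simpa using hv
    | succ k ih =>
      rw [pow_succ', Module.End.mul_apply, ad_apply, leibniz_lie, he, ih, smul_lie, lie_smul,
        ← add_smul]
      congr 1
      push_cast
      ring
  have lower (k : ℕ) : ⁅f, (ad ℚ L e ^ (k + 1)) v⁆ =
      ((k + 1) * (n - k) : ℚ) • (ad ℚ L e ^ k) v := by
    have step (w : L) : ⁅f, ⁅e, w⁆⁆ = ⁅e, ⁅f, w⁆⁆ - ⁅h, w⁆ := by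
      rw [← hef, lie_lie, sub_sub_cancel]
    induction k with
    | zero => simp [step, fv, hv]
    | succ k ih =>
      rw [pow_succ', Module.End.mul_apply, ad_apply, step, ih, weight, lie_smul, ← ad_apply ℚ,
        ← Module.End.mul_apply, ← pow_succ', ← sub_smul]
      congr 1
      push_cast
      ring
  have hzero := lower (n + 1)
  rw [hnil, lie_zero, eq_comm, smul_eq_zero] at hzero
  refine hzero.resolve_left (mul_ne_zero (by positivity) ?_)
  push_cast
  norm_num

/-- The relations satisfied by one half of the Chevalley generators of `𝓕` together with the
opposite generator `g` and the coroot `t` of the second node. -/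
structure IsHalfSystem (a b c g t : L) : Prop where
  lie_a_c : ⁅a, c⁆ = 0
  lie_b_b_c : ⁅b, ⁅b, c⁆⁆ = 0
  lie_c_c_b : ⁅c, ⁅c, b⁆⁆ = 0
  lie_b_b_b_a : ⁅b, ⁅b, ⁅b, a⁆⁆⁆ = 0
  lie_a_a_a_b : ⁅a, ⁅a, ⁅a, b⁆⁆⁆ = 0
  lie_b_g : ⁅b, g⁆ = t
  lie_a_g : ⁅a, g⁆ = 0
  lie_c_g : ⁅c, g⁆ = 0
  lie_t_b : ⁅t, b⁆ = (2 : ℚ) • b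
  lie_t_a : ⁅t, a⁆ = (-2 : ℚ) • a
  lie_t_c : ⁅t, c⁆ = (-1 : ℚ) • c

namespace IsHalfSystem

variable {a b c g t : L}

theorem lie_root_g (H : IsHalfSystem a b c g t) : ⁅⁅a, ⁅a, ⁅b, c⁆⁆⁆, g⁆ = 0 := by
  simp only [lie_lie _ _ g, H.lie_a_g, H.lie_c_g, H.lie_b_g, lie_zero, zero_sub, sub_zero]
  rw [← lie_skew c t, H.lie_t_c]
  simp [H.lie_a_c]

theorem lie_t_root (H : IsHalfSystem a b c g t) :
    ⁅t, ⁅a, ⁅a, ⁅b, c⁆⁆⁆⁆ = (-3 : ℚ) • ⁅a, ⁅a, ⁅b, c⁆⁆⁆ := by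
  simp only [leibniz_lie t, H.lie_t_a, H.lie_t_b, H.lie_t_c, smul_lie, lie_smul, ← add_smul]
  norm_num

theorem ad_b_pow_three_lie_a (H : IsHalfSystem a b c g t) :
    (ad ℚ L b ^ 3) ⁅a, ⁅b, c⁆⁆ = 0 :=
  ad_pow_lie_eq_zero (m := 2) (n := 0) (by simpa [pow_succ] using H.lie_b_b_b_a)
    (by simpa using H.lie_b_b_c)

theorem ad_b_pow_four_root (H : IsHalfSystem a b c g t) :
    (ad ℚ L b ^ 4) ⁅a, ⁅a, ⁅b, c⁆⁆⁆ = 0 := by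
  refine ad_pow_succ_eq_zero_of_lowest_weight (n := 3) H.lie_b_g H.lie_t_b
    (by simpa using H.lie_t_root) (by rw [← lie_skew, H.lie_root_g, neg_zero]) ?_
  exact ad_pow_lie_eq_zero (m := 2) (n := 2) (by simpa [pow_succ] using H.lie_b_b_b_a)
    H.ad_b_pow_three_lie_a

theorem ad_lie_pow_four (H : IsHalfSystem a b c g t) (j : ℕ) :
    (ad ℚ L ⁅b, c⁆ ^ 4) ((ad ℚ L a ^ j) b) = 0 := by
  have hba : ⁅b, ⁅b, ⁅a, b⁆⁆⁆ = 0 := by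
    rw [← lie_skew a b, lie_neg, lie_neg, H.lie_b_b_b_a, neg_zero]
  have hca : ⁅c, a⁆ = 0 := by rw [← lie_skew, H.lie_a_c, neg_zero]
  have hcb : ⁅c, b⁆ = -⁅b, c⁆ := (lie_skew c b).symm
  have hcbc : ⁅c, ⁅b, c⁆⁆ = 0 := by rw [← lie_skew b c, lie_neg, H.lie_c_c_b, neg_zero]
  have reduce {y : L} (h0 : (ad ℚ L b ^ 4) y = 0) (h1 : (ad ℚ L b ^ 4) ⁅c, y⁆ = 0)
      (h2 : ⁅c, ⁅c, y⁆⁆ = 0) : (ad ℚ L ⁅b, c⁆ ^ 4) y = 0 := by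
    have := ad_ad_pow_pow_eq_zero (d := c) (x := -b) (y := y) (k := 1) (n := 4)
      (by simp [pow_succ, hcbc]) (fun j => by
        rw [map_neg, Even.neg_pow (by decide)]
        match j with
        | 0 => simpa using h0
        | 1 => simpa using h1
        | j + 2 => rw [pow_add, Module.End.mul_apply]; simp [pow_two, h2])
    simpa using this
  match j with
  | 0 =>
    refine Module.End.pow_map_zero_of_le (show 1 ≤ 4 by norm_num) ?_
    rw [pow_one, pow_zero, Module.End.one_apply, ad_apply, ← lie_skew, H.lie_b_b_c, neg_zero]
  | 1 =>
    rw [pow_one, ad_apply]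
    refine reduce (Module.End.pow_map_zero_of_le (show 2 ≤ 4 by norm_num)
      (by simpa [pow_two] using hba)) ?_ ?_
    · rw [leibniz_lie, hca, hcb, zero_lie, zero_add, lie_neg, map_neg, neg_eq_zero]
      exact Module.End.pow_map_zero_of_le (show 3 ≤ 4 by norm_num) H.ad_b_pow_three_lie_a
    · simp only [leibniz_lie c a, hca, H.lie_c_c_b, zero_lie, zero_add, lie_zero]
  | 2 =>
    rw [pow_two, Module.End.mul_apply, ad_apply, ad_apply]
    refine reduce ?_ ?_ ?_
    · exact ad_pow_lie_eq_zero (m := 2) (n := 1) (by simpa [pow_succ] using H.lie_b_b_b_a)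
        (by simpa [pow_two] using hba)
    · have : ⁅c, ⁅a, ⁅a, b⁆⁆⁆ = -⁅a, ⁅a, ⁅b, c⁆⁆⁆ := by
        simp only [leibniz_lie c a, hca, hcb, zero_lie, zero_add, lie_neg]
      rw [this, map_neg, H.ad_b_pow_four_root, neg_zero]
    · simp only [leibniz_lie c a, hca, H.lie_c_c_b, zero_lie, zero_add, lie_zero]
  | j + 3 =>
    rw [pow_add, Module.End.mul_apply]
    simp [pow_succ, H.lie_a_a_a_b]

theorem ad_root_pow_four (H : IsHalfSystem a b c g t) :
    (ad ℚ L ⁅a, ⁅a, ⁅b, c⁆⁆⁆ ^ 4) b = 0 := by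
  have := ad_ad_pow_pow_eq_zero (d := a) (x := ⁅b, c⁆) (y := b) (k := 2) (n := 4)
    (by simp [pow_succ, leibniz_lie a _ c, -lie_lie, H.lie_a_c, H.lie_a_a_a_b]) H.ad_lie_pow_four
  simpa [pow_two] using this

end IsHalfSystem

end LieAlgebra

theorem mk_eq_zero_of_mem_toSet {x : FreeLieAlgebra ℚ (Generators (Fin 3))}
    (hx : x ∈ Relations.toSet ℚ Amat) :
    (LieSubmodule.Quotient.mk (N := Relations.toIdeal ℚ Amat) x : 𝓕) = 0 :=
  (LieSubmodule.Quotient.mk_eq_zero' (N := Relations.toIdeal ℚ Amat)).2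
    (LieSubmodule.subset_lieSpan hx)

theorem lie_e_f_self (i : Fin 3) : ⁅e i, f i⁆ = h i := by
  refine sub_eq_zero.1 (mk_eq_zero_of_mem_toSet
    (x := ⁅FreeLieAlgebra.of ℚ (Generators.E i), FreeLieAlgebra.of ℚ (Generators.F i)⁆ -
      FreeLieAlgebra.of ℚ (Generators.H i)) ?_)
  iterate 4 left
  right
  exact ⟨(i, i), by simp [Relations.EF]⟩

theorem lie_e_f_of_ne {i j : Fin 3} (hij : i ≠ j) : ⁅e i, f j⁆ = 0 := by
  refine mk_eq_zero_of_mem_toSet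
    (x := ⁅FreeLieAlgebra.of ℚ (Generators.E i), FreeLieAlgebra.of ℚ (Generators.F j)⁆) ?_
  iterate 4 left
  right
  exact ⟨(i, j), by simp [Relations.EF, hij]⟩

theorem lie_h_e (i j : Fin 3) : ⁅h i, e j⁆ = (Amat i j : ℚ) • e j := by
  rw [Int.cast_smul_eq_zsmul]
  refine sub_eq_zero.1 (mk_eq_zero_of_mem_toSet
    (x := ⁅FreeLieAlgebra.of ℚ (Generators.H i), FreeLieAlgebra.of ℚ (Generators.E j)⁆ -
      Amat i j • FreeLieAlgebra.of ℚ (Generators.E j)) ?_)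
  iterate 3 left
  right
  exact ⟨(i, j), rfl⟩

theorem lie_h_f (i j : Fin 3) : ⁅h i, f j⁆ = (-Amat i j : ℚ) • f j := by
  rw [neg_smul, Int.cast_smul_eq_zsmul]
  refine eq_neg_of_add_eq_zero_left (mk_eq_zero_of_mem_toSet
    (x := ⁅FreeLieAlgebra.of ℚ (Generators.H i), FreeLieAlgebra.of ℚ (Generators.F j)⁆ +
      Amat i j • FreeLieAlgebra.of ℚ (Generators.F j)) ?_)
  iterate 2 left
  right
  exact ⟨(i, j), rfl⟩

theorem mk_ad_pow (x y : FreeLieAlgebra ℚ (Generators (Fin 3))) (n : ℕ) :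
    (LieSubmodule.Quotient.mk (N := Relations.toIdeal ℚ Amat)
      ((LieAlgebra.ad ℚ _ x ^ n) y) : 𝓕) =
    (LieAlgebra.ad ℚ 𝓕 (LieSubmodule.Quotient.mk (N := Relations.toIdeal ℚ Amat) x) ^ n)
      (LieSubmodule.Quotient.mk (N := Relations.toIdeal ℚ Amat) y) := by
  induction n with
  | zero => rfl
  | succ n ih =>
    simp only [pow_succ']
    exact congrArg (LieAlgebra.ad ℚ 𝓕
      (LieSubmodule.Quotient.mk (N := Relations.toIdeal ℚ Amat) x)) ih

theorem ad_e_pow_lie (i j : Fin 3) :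
    (LieAlgebra.ad ℚ 𝓕 (e i) ^ (-Amat i j).toNat) ⁅e i, e j⁆ = 0 :=
  (mk_ad_pow _ _ _).symm.trans <| mk_eq_zero_of_mem_toSet <| .inl <| .inr ⟨(i, j), rfl⟩

theorem ad_f_pow_lie (i j : Fin 3) :
    (LieAlgebra.ad ℚ 𝓕 (f i) ^ (-Amat i j).toNat) ⁅f i, f j⁆ = 0 :=
  (mk_ad_pow _ _ _).symm.trans <| mk_eq_zero_of_mem_toSet <| .inr ⟨(i, j), rfl⟩

theorem isHalfSystem_e : IsHalfSystem (e 0) (e 1) (e 2) (f 1) (h 1) where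
  lie_a_c := by simpa [Amat] using ad_e_pow_lie 0 2
  lie_b_b_c := by simpa [Amat] using ad_e_pow_lie 1 2
  lie_c_c_b := by simpa [Amat] using ad_e_pow_lie 2 1
  lie_b_b_b_a := by simpa [Amat, pow_two] using ad_e_pow_lie 1 0
  lie_a_a_a_b := by simpa [Amat, pow_two] using ad_e_pow_lie 0 1
  lie_b_g := lie_e_f_self 1
  lie_a_g := lie_e_f_of_ne (by decide)
  lie_c_g := lie_e_f_of_ne (by decide)
  lie_t_b := by simpa [Amat] using lie_h_e 1 1
  lie_t_a := by simpa [Amat] using lie_h_e 1 0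
  lie_t_c := by simpa [Amat] using lie_h_e 1 2

theorem isHalfSystem_f : IsHalfSystem (f 0) (f 1) (f 2) (e 1) (-h 1) where
  lie_a_c := by simpa [Amat] using ad_f_pow_lie 0 2
  lie_b_b_c := by simpa [Amat] using ad_f_pow_lie 1 2
  lie_c_c_b := by simpa [Amat] using ad_f_pow_lie 2 1
  lie_b_b_b_a := by simpa [Amat, pow_two] using ad_f_pow_lie 1 0
  lie_a_a_a_b := by simpa [Amat, pow_two] using ad_f_pow_lie 0 1
  lie_b_g := by rw [← lie_skew, lie_e_f_self]
  lie_a_g := by rw [← lie_skew, lie_e_f_of_ne (by decide), neg_zero]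
  lie_c_g := by rw [← lie_skew, lie_e_f_of_ne (by decide), neg_zero]
  lie_t_b := by simp [lie_h_f, Amat]
  lie_t_a := by simp [lie_h_f, Amat]
  lie_t_c := by simp [lie_h_f, Amat]

theorem lie_H₁_e (j : Fin 3) :
    ⁅H₁, e j⁆ = (2 * Amat 0 j + Amat 1 j + Amat 2 j : ℚ) • e j := by
  simp only [H₁, add_lie, smul_lie, lie_h_e, smul_smul, ← add_smul]

theorem lie_H₁_E₁ : ⁅H₁, E₁⁆ = (2 : ℚ) • E₁ := by
  simp only [E₁, lie_smul, leibniz_lie H₁, lie_H₁_e, smul_lie, smul_smul, ← add_smul]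
  simp [Amat]
  norm_num

theorem ad_smul_pow_four {x y : 𝓕} (c : ℚ) (hxy : (LieAlgebra.ad ℚ 𝓕 x ^ 4) y = 0) :
    (LieAlgebra.ad ℚ 𝓕 (c • x) ^ 4) y = 0 := by
  rw [map_smul, smul_pow, LinearMap.smul_apply, hxy, smul_zero]

theorem F₁_eq : F₁ = (-(1 / 2) : ℚ) • ⁅f 0, ⁅f 0, ⁅f 1, f 2⁆⁆⁆ :=
  (neg_smul _ _).symm


/-- The relations ⁅E₁,F₂⁆ = 0, ⁅E₂,F₁⁆ = 0, ⁅H₁,E₁⁆ = 2E₁, ⁅H₂,E₂⁆ = 2E₂, ⁅H₁,E₂⁆ = -3E₂,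
⁅H₂,E₁⁆ = -3E₁, and the Serre-type vanishings (ad E₂)⁴E₁ = 0, (ad E₁)⁴E₂ = 0,
(ad F₂)⁴F₁ = 0, (ad F₁)⁴F₂ = 0, all hold in 𝓕. -/
theorem fib_serre_relations_in_F :
    ⁅E₁, F₂⁆ = 0 ∧ ⁅E₂, F₁⁆ = 0 ∧
    ⁅H₁, E₁⁆ = (2 : ℚ) • E₁ ∧ ⁅H₂, E₂⁆ = (2 : ℚ) • E₂ ∧
    ⁅H₁, E₂⁆ = (-3 : ℚ) • E₂ ∧ ⁅H₂, E₁⁆ = (-3 : ℚ) • E₁ ∧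
    ((LieAlgebra.ad ℚ 𝓕 E₂) ^ 4) E₁ = 0 ∧
    ((LieAlgebra.ad ℚ 𝓕 E₁) ^ 4) E₂ = 0 ∧
    ((LieAlgebra.ad ℚ 𝓕 F₂) ^ 4) F₁ = 0 ∧
    ((LieAlgebra.ad ℚ 𝓕 F₁) ^ 4) F₂ = 0 := by
  refine ⟨?_, ?_, lie_H₁_E₁, isHalfSystem_e.lie_t_b, ?_, ?_, ?_, ?_, ?_, ?_⟩
  · rw [E₁, F₂, smul_lie, isHalfSystem_e.lie_root_g, smul_zero]
  · rw [F₁_eq, E₂, lie_smul, ← lie_skew, isHalfSystem_f.lie_root_g, neg_zero, smul_zero]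
  · rw [E₂, lie_H₁_e]
    simp [Amat]
    norm_num
  · rw [E₁, H₂, lie_smul, isHalfSystem_e.lie_t_root, smul_comm]
  · rw [E₁, E₂, map_smul, isHalfSystem_e.ad_b_pow_four_root, smul_zero]
  · exact ad_smul_pow_four _ isHalfSystem_e.ad_root_pow_four
  · rw [F₁_eq, F₂, map_smul, isHalfSystem_f.ad_b_pow_four_root, smul_zero]
  · rw [F₁_eq]
    exact ad_smul_pow_four _ isHalfSystem_f.ad_root_pow_four

end
end

section
/- For each m ∈ {-2,-1,1,2}, set ρ₋₂ := -α₃, ρ₋₁ := α₁, ρ₁ := -α₁, ρ₂ := α₃. Then the projections of the level-m real roots form a single W_Fib-orbit: {π(β) : β ∈ Q, ‖β‖² = 2, Fib-level of β = m} = {w(π(ρ_m)) : w ∈ W_Fib}. -/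
/-! Statement 15: for m ∈ {-2,-1,1,2}, the projections of the level-m real roots form a
single W_Fib-orbit, that of π(ρ_m) with ρ₋₂ = -α₃, ρ₋₁ = α₁, ρ₁ = -α₁, ρ₂ = α₃. -/

noncomputable section

open Matrix

/-- The symmetric 2×2 real matrix [[a,b],[b,c]]. -/
def sm (a b c : ℝ) : Matrix (Fin 2) (Fin 2) ℝ := !![a, b; b, c]

/-- The simple root α₁ = [[0,1],[1,0]] of 𝓕. -/
def α₁ : Matrix (Fin 2) (Fin 2) ℝ := sm 0 1 0

/-- The simple root α₂ = [[-1,-1],[-1,0]] of 𝓕. -/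
def α₂ : Matrix (Fin 2) (Fin 2) ℝ := sm (-1) (-1) 0

/-- The simple root α₃ = [[1,0],[0,-1]] of 𝓕. -/
def α₃ : Matrix (Fin 2) (Fin 2) ℝ := sm 1 0 (-1)

/-- The simple root β₁ = 2α₁+α₂+α₃ = [[0,1],[1,-1]] of 𝓕ib. -/
def β₁ : Matrix (Fin 2) (Fin 2) ℝ := sm 0 1 (-1)

/-- The simple root β₂ = α₂ of 𝓕ib. -/
def β₂ : Matrix (Fin 2) (Fin 2) ℝ := α₂

/-- The bilinear pairing ([[a,b],[b,c]], [[a',b'],[b',c']]) = 2bb' - ac' - a'c. -/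
def pair (x y : Matrix (Fin 2) (Fin 2) ℝ) : ℝ :=
  2 * x 0 1 * y 0 1 - x 0 0 * y 1 1 - y 0 0 * x 1 1

/-- The squared length ‖[[a,b],[b,c]]‖² = 2(b² - ac) = -2·det. -/
def sqLen (x : Matrix (Fin 2) (Fin 2) ℝ) : ℝ := pair x x

/-- The root lattice Q: all ℤ-linear combinations of α₁, α₂, α₃
(equivalently, all symmetric 2×2 integer matrices). -/
def Q : Set (Matrix (Fin 2) (Fin 2) ℝ) :=
  {γ | ∃ x y z : ℤ, γ = (x : ℝ) • α₁ + (y : ℝ) • α₂ + (z : ℝ) • α₃}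

/-- The Fib root lattice Q_Fib = ℤβ₁ + ℤβ₂. -/
def QFib : Set (Matrix (Fin 2) (Fin 2) ℝ) :=
  {γ | ∃ p q : ℤ, γ = (p : ℝ) • β₁ + (q : ℝ) • β₂}

/-- The root system Φ = {γ ∈ Q : γ ≠ 0 and ‖γ‖² ≤ 2} of 𝓕. -/
def Φ : Set (Matrix (Fin 2) (Fin 2) ℝ) := {γ ∈ Q | γ ≠ 0 ∧ sqLen γ ≤ 2}

/-- The Fib-level of [[a,b],[b,c]] is a - b - c. -/
def lvl (x : Matrix (Fin 2) (Fin 2) ℝ) : ℝ := x 0 0 - x 0 1 - x 1 1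

/-- The set Δ_m of Fib-level-m roots of 𝓕. -/
def Δ (m : ℤ) : Set (Matrix (Fin 2) (Fin 2) ℝ) := {γ ∈ Φ | lvl γ = (m : ℝ)}

/-- The projection to the Fib-plane: π(β) = β + ((a-b-c)/5)·[[-2,1],[1,2]],
where [[-2,1],[1,2]] = α₁ - 2α₃. -/
def proj (x : Matrix (Fin 2) (Fin 2) ℝ) : Matrix (Fin 2) (Fin 2) ℝ :=
  x + (lvl x / 5) • sm (-2) 1 2

/-- The simple reflection r₁ : β ↦ MβMᵀ with M = [[-1,0],[1,1]]. -/
def r₁ : Matrix (Fin 2) (Fin 2) ℝ → Matrix (Fin 2) (Fin 2) ℝ :=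
  fun x => !![(-1 : ℝ), 0; 1, 1] * x * (!![(-1 : ℝ), 0; 1, 1])ᵀ

/-- The simple reflection r₂ : β ↦ NβNᵀ with N = [[-1,1],[0,1]]. -/
def r₂ : Matrix (Fin 2) (Fin 2) ℝ → Matrix (Fin 2) (Fin 2) ℝ :=
  fun x => !![(-1 : ℝ), 1; 0, 1] * x * (!![(-1 : ℝ), 1; 0, 1])ᵀ

/-- The Fib Weyl group W_Fib: the collection of self-maps of the space of symmetric 2×2
real matrices generated by r₁ and r₂ under composition (a group, since r₁ and r₂ are
involutions). -/
def WFib : Submonoid (Function.End (Matrix (Fin 2) (Fin 2) ℝ)) :=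
  Submonoid.closure {r₁, r₂}

/-- ρ₋₂ := -α₃, ρ₋₁ := α₁, ρ₁ := -α₁, ρ₂ := α₃. -/
def ρm (m : ℤ) : Matrix (Fin 2) (Fin 2) ℝ :=
  if m = -2 then -α₃ else if m = -1 then α₁ else if m = 1 then -α₁ else α₃

lemma r₁_sm (a b c : ℝ) : r₁ (sm a b c) = sm a (-a - b) (a + 2 * b + c) := by
  ext i j
  fin_cases i <;> fin_cases j <;>
    simp [r₁, sm, Matrix.mul_apply, Fin.sum_univ_two] <;> ring

lemma r₂_sm (a b c : ℝ) : r₂ (sm a b c) = sm (a - 2 * b + c) (c - b) c := by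
  ext i j
  fin_cases i <;> fin_cases j <;>
    simp [r₂, sm, Matrix.mul_apply, Fin.sum_univ_two] <;> ring

lemma proj_sm (a b c : ℝ) :
    proj (sm a b c) = sm (a - 2 * ((a - b - c) / 5)) (b + (a - b - c) / 5)
      (c + 2 * ((a - b - c) / 5)) := by
  ext i j
  fin_cases i <;> fin_cases j <;> simp [proj, lvl, sm] <;> ring

lemma r₁_proj_sm (a b c : ℝ) :
    r₁ (proj (sm a b c)) = proj (sm a (-a - b) (a + 2 * b + c)) := by
  rw [proj_sm, proj_sm, r₁_sm]
  congr 1 <;> ring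

lemma r₂_proj_sm (a b c : ℝ) :
    r₂ (proj (sm a b c)) = proj (sm (a - 2 * b + c) (c - b) c) := by
  rw [proj_sm, proj_sm, r₂_sm]
  congr 1 <;> ring

lemma sqLen_sm (a b c : ℝ) : sqLen (sm a b c) = 2 * (b ^ 2 - a * c) := by
  simp [sqLen, pair, sm]
  ring

lemma lvl_sm (a b c : ℝ) : lvl (sm a b c) = a - b - c := by
  simp [lvl, sm]

lemma mem_Q_iff (γ : Matrix (Fin 2) (Fin 2) ℝ) :
    γ ∈ Q ↔ ∃ a b c : ℤ, γ = sm a b c := by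
  constructor
  · rintro ⟨x, y, z, rfl⟩
    refine ⟨z - y, x - y, -z, ?_⟩
    ext i j
    fin_cases i <;> fin_cases j <;> simp [α₁, α₂, α₃, sm] <;> ring
  · rintro ⟨a, b, c, rfl⟩
    refine ⟨b - c - a, -c - a, -c, ?_⟩
    ext i j
    fin_cases i <;> fin_cases j <;> simp [α₁, α₂, α₃, sm] <;> ring

/-- The projected real roots of level `m`, in integer coordinates. -/
lemma exists_level_root_iff (m : ℤ) (x : Matrix (Fin 2) (Fin 2) ℝ) :
    (∃ β ∈ Q, sqLen β = 2 ∧ lvl β = (m : ℝ) ∧ x = proj β) ↔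
      ∃ a b c : ℤ, b ^ 2 - a * c = 1 ∧ a - b - c = m ∧ x = proj (sm a b c) := by
  constructor
  · rintro ⟨β, hβ, hs, hl, rfl⟩
    obtain ⟨a, b, c, rfl⟩ := (mem_Q_iff β).1 hβ
    rw [sqLen_sm] at hs
    rw [lvl_sm] at hl
    refine ⟨a, b, c, ?_, by exact_mod_cast hl, rfl⟩
    have h : (b : ℝ) ^ 2 - a * c = 1 := by linarith
    exact_mod_cast h
  · rintro ⟨a, b, c, hs, hl, rfl⟩
    refine ⟨_, (mem_Q_iff _).2 ⟨a, b, c, rfl⟩, ?_, ?_, rfl⟩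
    · have h : (b : ℝ) ^ 2 - a * c = 1 := by exact_mod_cast hs
      rw [sqLen_sm, h, mul_one]
    · rw [lvl_sm]
      exact_mod_cast hl

/-- A real root of positive level whose diagonal entries are shrunk by neither reflection
has `|b| ≤ 1`. -/
lemma abs_le_one_of_minimal {m a b c : ℤ} (hm : m = 1 ∨ m = 2)
    (hs : b ^ 2 - a * c = 1) (hl : a - b - c = m)
    (h₂ : a.natAbs ≤ (a - 2 * b + c).natAbs) (h₁ : c.natAbs ≤ (a + 2 * b + c).natAbs) :
    -1 ≤ b ∧ b ≤ 1 := by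
  by_contra hb
  have hb' : b ≤ -2 ∨ 2 ≤ b := by omega
  have hac : 0 < a * c := by rcases hb' with h | h <;> nlinarith
  have hquad : b * (b + 1) ≠ 2 - m := by
    rcases hm with rfl | rfl <;> rcases hb' with h | h <;> nlinarith
  rcases pos_and_pos_or_neg_and_neg_of_mul_pos hac with ⟨ha, hc⟩ | ⟨ha, hc⟩
  · have hcb : 2 * b ≤ c := by omega
    by_cases ha1 : a = 1
    · subst ha1
      exact hquad (by linarith)
    have hab : -2 * b ≤ a := by omega
    rcases hb' with h | h
    · nlinarith [mul_le_mul hab (show -2 * b ≤ c by omega) (by omega) ha.le]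
    · nlinarith [mul_le_mul (show 2 * b ≤ a by omega) hcb (by omega) ha.le]
  · have hab : a ≤ -2 * b := by omega
    by_cases hc1 : c = -1
    · subst hc1
      exact hquad (by linarith)
    have hcb : c ≤ 2 * b := by omega
    rcases hb' with h | h
    · nlinarith [mul_le_mul (show -2 * b ≤ -a by omega) (show -2 * b ≤ -c by omega)
        (by omega) (by omega)]
    · nlinarith [mul_le_mul (show 2 * b ≤ -a by omega) (show 2 * b ≤ -c by omega)
        (by omega) (by omega)]

/-- Descent for real roots of level `1` or `2`. -/
lemma level_root_induction {m : ℤ} (hm : m = 1 ∨ m = 2) {S : ℤ → ℤ → ℤ → Prop}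
    (h₁ : ∀ a b c, S a b c → S a (-a - b) (a + 2 * b + c))
    (h₂ : ∀ a b c, S a b c → S (a - 2 * b + c) (c - b) c)
    (hbase₁ : m = 1 → S 0 (-1) 0) (hbase₂ : m = 2 → S 1 0 (-1))
    (a b c : ℤ) (hs : b ^ 2 - a * c = 1) (hl : a - b - c = m) : S a b c := by
  induction hn : a.natAbs + c.natAbs using Nat.strong_induction_on generalizing a b c with
  | _ n ih =>
  by_cases ha : a.natAbs ≤ (a - 2 * b + c).natAbs
  swap
  · have := h₂ _ _ _ (ih _ (by omega) (a - 2 * b + c) (c - b) c (by linarith)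
      (by linarith) rfl)
    convert this using 1 <;> ring
  by_cases hc : c.natAbs ≤ (a + 2 * b + c).natAbs
  swap
  · have := h₁ _ _ _ (ih _ (by omega) a (-a - b) (a + 2 * b + c) (by linarith)
      (by linarith) rfl)
    convert this using 1 <;> ring
  obtain ⟨hb₀, hb₁⟩ := abs_le_one_of_minimal hm hs hl ha hc
  obtain rfl : a = b + c + m := by omega
  have hcases : b = -1 ∨ b = 0 ∨ b = 1 := by omega
  rcases hm with rfl | rfl
  · rcases hcases with rfl | rfl | rfl
    · obtain rfl : c = 0 := by
        have h : c * c = 0 := by linarith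
        exact mul_self_eq_zero.1 h
      exact hbase₁ rfl
    · exfalso
      rcases le_or_gt 0 c with h | h <;> nlinarith
    · have h : c * (c + 2) = 0 := by linarith
      rcases mul_eq_zero.1 h with h | h <;> omega
  · rcases hcases with rfl | rfl | rfl
    · have h : c * (c + 1) = 0 := by linarith
      rcases mul_eq_zero.1 h with h | h
      · obtain rfl := h
        exact h₁ _ _ _ (hbase₂ rfl)
      · obtain rfl : c = -1 := by omega
        exact h₂ _ _ _ (hbase₂ rfl)
    · obtain rfl : c = -1 := by
        have h : (c + 1) * (c + 1) = 0 := by linarith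
        have := mul_self_eq_zero.1 h
        omega
      exact hbase₂ rfl
    · have h : c * (c + 3) = 0 := by linarith
      rcases mul_eq_zero.1 h with h | h <;> omega

lemma exists_ρm_eq_sm {m : ℤ} (hm : m = -2 ∨ m = -1 ∨ m = 1 ∨ m = 2) :
    ∃ a b c : ℤ, b ^ 2 - a * c = 1 ∧ a - b - c = m ∧ ρm m = sm a b c := by
  rcases hm with rfl | rfl | rfl | rfl
  · refine ⟨-1, 0, 1, by norm_num, by norm_num, ?_⟩
    ext i j; fin_cases i <;> fin_cases j <;> simp [ρm, α₃, sm]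
  · refine ⟨0, 1, 0, by norm_num, by norm_num, ?_⟩
    ext i j; fin_cases i <;> fin_cases j <;> simp [ρm, α₁, sm]
  · refine ⟨0, -1, 0, by norm_num, by norm_num, ?_⟩
    ext i j; fin_cases i <;> fin_cases j <;> simp [ρm, α₁, sm]
  · refine ⟨1, 0, -1, by norm_num, by norm_num, ?_⟩
    ext i j; fin_cases i <;> fin_cases j <;> simp [ρm, α₃, sm]

/-- The orbit of `proj (ρm m)` contains the projection of every real root of level `m`. -/
lemma proj_mem_orbit {m : ℤ} (hm : m = -2 ∨ m = -1 ∨ m = 1 ∨ m = 2) (a b c : ℤ)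
    (hs : b ^ 2 - a * c = 1) (hl : a - b - c = m) :
    ∃ w ∈ WFib, proj (sm a b c) = w (proj (ρm m)) := by
  let S : ℤ → ℤ → ℤ → Prop := fun a b c => ∃ w ∈ WFib, proj (sm a b c) = w (proj (ρm m))
  have h₁ : ∀ a b c, S a b c → S a (-a - b) (a + 2 * b + c) := by
    rintro a b c ⟨w, hw, h⟩
    refine ⟨HMul.hMul (α := Function.End _) r₁ w,
      mul_mem (Submonoid.subset_closure (Set.mem_insert _ _)) hw, ?_⟩
    change _ = r₁ (w _)
    rw [← h, r₁_proj_sm]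
    push_cast
    rfl
  have h₂ : ∀ a b c, S a b c → S (a - 2 * b + c) (c - b) c := by
    rintro a b c ⟨w, hw, h⟩
    refine ⟨HMul.hMul (α := Function.End _) r₂ w,
      mul_mem (Submonoid.subset_closure (Set.mem_insert_of_mem _ rfl)) hw, ?_⟩
    change _ = r₂ (w _)
    rw [← h, r₂_proj_sm]
    push_cast
    rfl
  have hbase : ∀ a b c : ℤ, ρm m = sm a b c → S a b c := fun a b c h =>
    ⟨1, one_mem _, by rw [h]; rfl⟩
  by_cases hpos : m = 1 ∨ m = 2
  · refine level_root_induction hpos h₁ h₂ ?_ ?_ a b c hs hl <;> rintro rfl <;>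
      refine hbase _ _ _ ?_ <;> ext i j <;> fin_cases i <;> fin_cases j <;>
      simp [ρm, α₁, α₃, sm]
  · have hneg : -m = 1 ∨ -m = 2 := by omega
    have key := level_root_induction (S := fun a b c => S (-a) (-b) (-c)) hneg
      (fun a b c h => by convert h₁ _ _ _ h using 1 <;> ring)
      (fun a b c h => by convert h₂ _ _ _ h using 1 <;> ring)
      (fun h => by
        obtain rfl : m = -1 := by omega
        refine hbase _ _ _ ?_
        ext i j; fin_cases i <;> fin_cases j <;> simp [ρm, α₁, sm])
      (fun h => by
        obtain rfl : m = -2 := by omega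
        refine hbase _ _ _ ?_
        ext i j; fin_cases i <;> fin_cases j <;> simp [ρm, α₃, sm])
      (-a) (-b) (-c) (by linarith) (by linarith)
    simpa only [neg_neg] using key

/-- `W_Fib` preserves the set of projected real roots of level `m`. -/
lemma exists_level_root_of_mem_WFib {m : ℤ} {w : Function.End (Matrix (Fin 2) (Fin 2) ℝ)}
    (hw : w ∈ WFib) : ∀ x : Matrix (Fin 2) (Fin 2) ℝ,
      (∃ a b c : ℤ, b ^ 2 - a * c = 1 ∧ a - b - c = m ∧ x = proj (sm a b c)) →
      ∃ a b c : ℤ, b ^ 2 - a * c = 1 ∧ a - b - c = m ∧ w x = proj (sm a b c) := by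
  induction hw using Submonoid.closure_induction with
  | mem w hw =>
    rintro x ⟨a, b, c, hs, hl, rfl⟩
    rcases hw with rfl | rfl
    · refine ⟨a, -a - b, a + 2 * b + c, by linarith, by linarith, ?_⟩
      rw [r₁_proj_sm]
      push_cast
      rfl
    · refine ⟨a - 2 * b + c, c - b, c, by linarith, by linarith, ?_⟩
      rw [r₂_proj_sm]
      push_cast
      rfl
  | one => exact fun x h => h
  | mul v w _ _ hv hw => exact fun x h => hv _ (hw x h)

/-- For m ∈ {-2,-1,1,2}:
{π(β) : β ∈ Q, ‖β‖² = 2, Fib-level of β = m} = {w(π(ρ_m)) : w ∈ W_Fib}. -/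
theorem level_real_roots_single_orbit (m : ℤ) (hm : m = -2 ∨ m = -1 ∨ m = 1 ∨ m = 2) :
    {x | ∃ β ∈ Q, sqLen β = 2 ∧ lvl β = (m : ℝ) ∧ x = proj β}
      = {x | ∃ w ∈ WFib, x = w (proj (ρm m))} := by
  ext x
  simp only [Set.mem_ofPred_eq]
  rw [exists_level_root_iff]
  constructor
  · rintro ⟨a, b, c, hs, hl, rfl⟩
    exact proj_mem_orbit hm a b c hs hl
  · rintro ⟨w, hw, rfl⟩
    obtain ⟨a, b, c, hs, hl, hρ⟩ := exists_ρm_eq_sm hm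
    exact exists_level_root_of_mem_WFib hw _ ⟨a, b, c, hs, hl, by rw [hρ]⟩

end
end
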